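/- arXiv:2504.09711 — 2 statements merged into one kernel-verified Lean document; each statement's English description precedes it below -/
import Mathlib

section
/- Limit of the Kalman gain under a non-informative input prior: for every sequence (D_k) of symmetric positive definite m×m matrices with D_k⁻¹ → 0, the Kalman gains K(D_k) := (X + G D_k Gᵀ) Cᵀ (S + C G D_k Gᵀ Cᵀ)⁻¹ converge to G 𝓛 + 𝒥 (I_p − C G 𝓛), where 𝓛 = 𝒯⁻¹ Gᵀ Cᵀ S⁻¹ and 𝒥 = X Cᵀ S⁻¹. -/
open Matrix Filter

/-- Over a field, a matrix whose rank equals its number of columns acts injectively. -/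
theorem Matrix.mulVec_injective_of_rank_eq_card {ι κ : Type*} {K : Type*} [Fintype ι]
    [Fintype κ] [Field K] {A : Matrix ι κ K} (h : A.rank = Fintype.card κ) :
    Function.Injective A.mulVec := by
  rw [Matrix.mulVec_injective_iff, linearIndependent_iff_card_eq_finrank_span, ← h,
    A.rank_eq_finrank_span_cols]
  rfl

/-- Matrix inversion is continuous along limits that are invertible. -/
theorem Matrix.tendsto_nonsing_inv {ι α : Type*} [Fintype ι] [DecidableEq ι] {l : Filter α}
    {f : α → Matrix ι ι ℝ} {A : Matrix ι ι ℝ} (hA : IsUnit A.det)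
    (hf : Tendsto f l (nhds A)) : Tendsto (fun a => (f a)⁻¹) l (nhds A⁻¹) :=
  (continuousAt_matrix_inv A (by
    simpa only [Ring.inverse_eq_inv'] using continuousAt_inv₀ hA.ne_zero)).tendsto.comp hf

/-- A form of the Woodbury identity. -/
theorem Matrix.inv_add_mul_mul_transpose {ι κ : Type*} {K : Type*} [Fintype ι] [DecidableEq ι]
    [Fintype κ] [DecidableEq κ] [CommRing K] {S : Matrix ι ι K} {D : Matrix κ κ K}
    {F : Matrix ι κ K} (hS : IsUnit S.det) (hD : IsUnit D.det)
    (hDT : IsUnit (D⁻¹ + Fᵀ * S⁻¹ * F).det) :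
    (S + F * D * Fᵀ)⁻¹ = S⁻¹ * (1 - F * ((D⁻¹ + Fᵀ * S⁻¹ * F)⁻¹ * (Fᵀ * S⁻¹))) ∧
      D * Fᵀ * (S + F * D * Fᵀ)⁻¹ = (D⁻¹ + Fᵀ * S⁻¹ * F)⁻¹ * (Fᵀ * S⁻¹) := by
  set N := (D⁻¹ + Fᵀ * S⁻¹ * F)⁻¹ * (Fᵀ * S⁻¹) with hN
  have hEN : (D⁻¹ + Fᵀ * S⁻¹ * F) * N = Fᵀ * S⁻¹ := mul_nonsing_inv_cancel_left _ _ hDT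
  have hgain : D * Fᵀ * (S⁻¹ * (1 - F * N)) = N := by
    have h : Fᵀ * S⁻¹ * (1 - F * N) = D⁻¹ * N := by
      rw [Matrix.mul_sub, Matrix.mul_one, ← Matrix.mul_assoc, sub_eq_iff_eq_add,
        ← Matrix.add_mul, hEN]
    rw [Matrix.mul_assoc, ← Matrix.mul_assoc Fᵀ, h, mul_nonsing_inv_cancel_left _ _ hD]
  have hinv : (S + F * D * Fᵀ)⁻¹ = S⁻¹ * (1 - F * N) := by
    refine inv_eq_right_inv ?_
    rw [Matrix.add_mul, mul_nonsing_inv_cancel_left _ _ hS, Matrix.mul_assoc F,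
      Matrix.mul_assoc F, hgain, sub_add_cancel]
  exact ⟨hinv, hinv ▸ hgain⟩

/-- Limit of the Kalman gain under a non-informative input prior. -/
theorem sise_kalman_gain_limit
    (n m p : ℕ) (hn : 0 < n) (hm : 0 < m) (hp : 0 < p)
    (C : Matrix (Fin p) (Fin n) ℝ) (G : Matrix (Fin n) (Fin m) ℝ)
    (R : Matrix (Fin p) (Fin p) ℝ) (hR : R.PosDef)
    (X : Matrix (Fin n) (Fin n) ℝ) (hX : X.PosSemidef)
    (S : Matrix (Fin p) (Fin p) ℝ) (hS : S = R + C * X * Cᵀ)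
    (T : Matrix (Fin m) (Fin m) ℝ) (hT : T = Gᵀ * Cᵀ * S⁻¹ * C * G)
    (hrank : (C * G).rank = m)
    (L : Matrix (Fin m) (Fin p) ℝ) (hL : L = T⁻¹ * (Gᵀ * Cᵀ * S⁻¹))
    (J : Matrix (Fin n) (Fin p) ℝ) (hJ : J = X * Cᵀ * S⁻¹)
    (D : ℕ → Matrix (Fin m) (Fin m) ℝ) (hD : ∀ k, (D k).PosDef)
    (hDinv : Tendsto (fun k => (D k)⁻¹) atTop (nhds 0)) :
    Tendsto (fun k => (X + G * D k * Gᵀ) * Cᵀ * (S + C * G * D k * Gᵀ * Cᵀ)⁻¹)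
      atTop (nhds (G * L + J * (1 - C * G * L))) := by
  have hSpos : S.PosDef := by
    rw [hS]
    exact hR.add_posSemidef (by simpa using hX.mul_mul_conjTranspose_same C)
  have hT' : T = (C * G)ᵀ * S⁻¹ * (C * G) := by
    rw [hT, transpose_mul]; simp only [Matrix.mul_assoc]
  have hTpos : T.PosDef := by
    rw [hT', ← conjTranspose_eq_transpose_of_trivial]
    exact hSpos.inv.conjTranspose_mul_mul_same
      (mulVec_injective_of_rank_eq_card (by simpa using hrank))
  have hunit : ∀ {q : ℕ} {A : Matrix (Fin q) (Fin q) ℝ}, A.PosDef → IsUnit A.det :=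
    fun h => isUnit_iff_ne_zero.2 h.det_pos.ne'
  have hgain : ∀ k, (X + G * D k * Gᵀ) * Cᵀ * (S + C * G * D k * Gᵀ * Cᵀ)⁻¹ =
      G * (((D k)⁻¹ + T)⁻¹ * (Gᵀ * Cᵀ * S⁻¹)) +
        J * (1 - C * G * (((D k)⁻¹ + T)⁻¹ * (Gᵀ * Cᵀ * S⁻¹))) := by
    intro k
    obtain ⟨h₁, h₂⟩ := inv_add_mul_mul_transpose (F := C * G) (hunit hSpos) (hunit (hD k))
      (hT' ▸ hunit ((hD k).inv.add hTpos))
    rw [← hT', transpose_mul] at h₁ h₂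
    rw [Matrix.mul_assoc (C * G * D k), Matrix.add_mul, Matrix.add_mul, add_comm, ← h₂, h₂,
      Matrix.mul_assoc (G * D k), Matrix.mul_assoc G, Matrix.mul_assoc G, h₂, h₁, hJ,
      Matrix.mul_assoc (X * Cᵀ)]
  simp only [hgain]
  have hlim : Tendsto (fun k => ((D k)⁻¹ + T)⁻¹ * (Gᵀ * Cᵀ * S⁻¹)) atTop (nhds L) := by
    rw [hL]
    have h := tendsto_nonsing_inv (hunit hTpos) (by simpa using hDinv.add_const T)
    exact ((continuous_id.matrix_mul continuous_const).tendsto T⁻¹).comp h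
  have hcont : Continuous fun N : Matrix (Fin m) (Fin p) ℝ => G * N + J * (1 - C * G * N) := by
    fun_prop
  exact (hcont.tendsto L).comp hlim
end

section
/- Limit of the Gaussian-sum weight ratio under a non-informative input prior: let X₁ and X₂ be two symmetric positive semidefinite n×n matrices, define S_i = R + C X_i Cᵀ, 𝒯_i = Gᵀ Cᵀ S_i⁻¹ C G, and L_i(D) = D Gᵀ Cᵀ (S_i + C G D Gᵀ Cᵀ)⁻¹ for i = 1, 2. Then for every sequence (D_k) of symmetric positive definite m×m matrices with D_k⁻¹ → 0, the ratio det(I_p − C G L₁(D_k)) / det(I_p − C G L₂(D_k)) converges to det(𝒯₂) / det(𝒯₁). -/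
open Matrix Filter

lemma Matrix.mulVec_injective_of_rank_eq {p m : ℕ} {F : Matrix (Fin p) (Fin m) ℝ}
    (hF : F.rank = m) : Function.Injective F.mulVec := by
  rw [Matrix.mulVec_injective_iff, linearIndependent_iff_card_eq_finrank_span, Fintype.card_fin,
    Set.finrank, ← Matrix.rank_eq_finrank_span_cols, hF]

lemma Matrix.PosDef.add_mul_mul_transpose {n p : ℕ} {R : Matrix (Fin p) (Fin p) ℝ}
    (hR : R.PosDef) {X : Matrix (Fin n) (Fin n) ℝ} (hX : X.PosSemidef)
    (C : Matrix (Fin p) (Fin n) ℝ) : (R + C * X * Cᵀ).PosDef := by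
  have h := hX.mul_mul_conjTranspose_same C
  rw [conjTranspose_eq_transpose_of_trivial] at h
  exact hR.add_posSemidef h

lemma Matrix.PosDef.transpose_mul_inv_mul {p m : ℕ} {S : Matrix (Fin p) (Fin p) ℝ}
    (hS : S.PosDef) {F : Matrix (Fin p) (Fin m) ℝ} (hF : F.rank = m) :
    (Fᵀ * S⁻¹ * F).PosDef := by
  have h := hS.inv.conjTranspose_mul_mul_same (mulVec_injective_of_rank_eq hF)
  rwa [conjTranspose_eq_transpose_of_trivial] at h

/-- The determinant of `1 - F L`, where `L = D Fᵀ (S + F D Fᵀ)⁻¹` is the gain matrix. -/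
lemma Matrix.PosDef.det_one_sub_mul_gain {p m : ℕ} {S : Matrix (Fin p) (Fin p) ℝ}
    (hS : S.PosDef) (F : Matrix (Fin p) (Fin m) ℝ) {D : Matrix (Fin m) (Fin m) ℝ}
    (hD : D.PosDef) :
    (1 - F * (D * Fᵀ * (S + F * D * Fᵀ)⁻¹)).det =
      ((D⁻¹ + Fᵀ * S⁻¹ * F).det * D.det)⁻¹ := by
  have hSu : IsUnit S.det := hS.det_pos.ne'.isUnit
  have hDu : IsUnit D.det := hD.det_pos.ne'.isUnit
  have hMu : IsUnit (S + F * D * Fᵀ).det :=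
    (hS.add_mul_mul_transpose hD.posSemidef F).det_pos.ne'.isUnit
  have hgain : 1 - F * (D * Fᵀ * (S + F * D * Fᵀ)⁻¹) = S * (S + F * D * Fᵀ)⁻¹ := by
    rw [sub_eq_iff_eq_add, ← Matrix.mul_assoc, ← Matrix.mul_assoc, ← Matrix.add_mul,
      mul_nonsing_inv _ hMu]
  have hdet : (S + F * D * Fᵀ).det = S.det * ((D⁻¹ + Fᵀ * S⁻¹ * F).det * D.det) := by
    have hfactor : S + F * D * Fᵀ = S * (1 + S⁻¹ * F * D * Fᵀ) := by
      simp only [Matrix.mul_add, Matrix.mul_one, Matrix.mul_assoc,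
        mul_nonsing_inv_cancel_left _ _ hSu]
    rw [hfactor, det_mul, det_one_add_mul_comm, ← det_mul, Matrix.add_mul,
      nonsing_inv_mul _ hDu]
    simp only [Matrix.mul_assoc]
  rw [hgain, det_mul, det_nonsing_inv, Ring.inverse_eq_inv', hdet, mul_inv,
    mul_inv_cancel_left₀ hS.det_pos.ne']

/-- Limit of the Gaussian-sum weight ratio under a non-informative input prior. -/
theorem sise_weight_ratio_limit
    (n m p : ℕ) (hn : 0 < n) (hm : 0 < m) (hp : 0 < p)
    (C : Matrix (Fin p) (Fin n) ℝ) (G : Matrix (Fin n) (Fin m) ℝ)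
    (R : Matrix (Fin p) (Fin p) ℝ) (hR : R.PosDef)
    (X₁ X₂ : Matrix (Fin n) (Fin n) ℝ) (hX₁ : X₁.PosSemidef) (hX₂ : X₂.PosSemidef)
    (S₁ S₂ : Matrix (Fin p) (Fin p) ℝ)
    (hS₁ : S₁ = R + C * X₁ * Cᵀ) (hS₂ : S₂ = R + C * X₂ * Cᵀ)
    (T₁ T₂ : Matrix (Fin m) (Fin m) ℝ)
    (hT₁ : T₁ = Gᵀ * Cᵀ * S₁⁻¹ * C * G) (hT₂ : T₂ = Gᵀ * Cᵀ * S₂⁻¹ * C * G)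
    (hrank : (C * G).rank = m)
    (D : ℕ → Matrix (Fin m) (Fin m) ℝ) (hD : ∀ k, (D k).PosDef)
    (hDinv : Tendsto (fun k => (D k)⁻¹) atTop (nhds 0)) :
    Tendsto
      (fun k =>
        (1 - C * G * (D k * Gᵀ * Cᵀ * (S₁ + C * G * D k * Gᵀ * Cᵀ)⁻¹)).det /
          (1 - C * G * (D k * Gᵀ * Cᵀ * (S₂ + C * G * D k * Gᵀ * Cᵀ)⁻¹)).det)
      atTop (nhds (T₂.det / T₁.det)) := by
  have hS₁pos : S₁.PosDef := hS₁ ▸ hR.add_mul_mul_transpose hX₁ C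
  have hS₂pos : S₂.PosDef := hS₂ ▸ hR.add_mul_mul_transpose hX₂ C
  have hT₁' : T₁ = (C * G)ᵀ * S₁⁻¹ * (C * G) := by
    rw [hT₁, transpose_mul]; simp only [Matrix.mul_assoc]
  have hT₂' : T₂ = (C * G)ᵀ * S₂⁻¹ * (C * G) := by
    rw [hT₂, transpose_mul]; simp only [Matrix.mul_assoc]
  have hT₁pos : T₁.PosDef := hT₁' ▸ hS₁pos.transpose_mul_inv_mul hrank
  have hlim (T : Matrix (Fin m) (Fin m) ℝ) :
      Tendsto (fun k => ((D k)⁻¹ + T).det) atTop (nhds T.det) := by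
    have hcont : Continuous fun A : Matrix (Fin m) (Fin m) ℝ => (A + T).det := by fun_prop
    simpa [Function.comp_def] using (hcont.tendsto 0).comp hDinv
  refine ((hlim T₂).div (hlim T₁) hT₁pos.det_pos.ne').congr fun k => ?_
  have h₁ := hS₁pos.det_one_sub_mul_gain (C * G) (hD k)
  have h₂ := hS₂pos.det_one_sub_mul_gain (C * G) (hD k)
  rw [← hT₁'] at h₁
  rw [← hT₂'] at h₂
  simp only [transpose_mul, ← Matrix.mul_assoc] at h₁ h₂ ⊢
  rw [h₁, h₂, inv_div_inv, mul_div_mul_right _ _ (hD k).det_pos.ne', Pi.div_apply]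
end
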